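/- arXiv:1308.5887 — 4 statements merged into one kernel-verified Lean document; each statement's English description precedes it below -/
import Mathlib

section
/- Let d ≥ 1, let K be a complex Hilbert space and let V = (V₁,…,V_d) be a row isometry on K. For multi-indices m, n ∈ ℕ^d (ordered componentwise, with n! = n₁!⋯n_d! and |n| = n₁+⋯+n_d): if n ≤ m then (V^{(n)})* V^{(m)} = (|n|!/n!) · V^{(m−n)}; if m ≤ n then (V^{(n)})* V^{(m)} = (|m|!/m!) · (V^{(n−m)})*; and if m and n are incomparable (neither n ≤ m nor m ≤ n) then (V^{(n)})* V^{(m)} = 0. -/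
open ContinuousLinearMap

/-- The symmetrized monomial `V^{(n)}` of a `d`-tuple of operators: the sum of all products
`V_{i₁} ∘ ⋯ ∘ V_{i_{|n|}}` over words of length `|n| = ∑ j, n j` containing exactly `n j`
occurrences of the letter `j` for each `j`. -/
noncomputable def symMonomial {d : ℕ} {K : Type*} [NormedAddCommGroup K]
    [InnerProductSpace ℂ K] (V : Fin d → (K →L[ℂ] K)) (n : Fin d → ℕ) : K →L[ℂ] K :=
  ∑ w ∈ Finset.univ.filter
      (fun w : Fin (∑ j, n j) → Fin d =>
        ∀ j, (Finset.univ.filter (fun i => w i = j)).card = n j),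
    (List.ofFn (fun i => V (w i))).prod

theorem single_one_le {d : ℕ} {n : Fin d → ℕ} {j : Fin d} (hj : 0 < n j) :
    Pi.single j 1 ≤ n := by
  intro i
  obtain rfl | h := eq_or_ne i j
  · simpa [Nat.one_le_iff_ne_zero] using hj.ne'
  · simp [h]

theorem sum_sub_single_add_one {d : ℕ} {n : Fin d → ℕ} {j : Fin d} (hj : 0 < n j) :
    ∑ i, (n - Pi.single j 1 : Fin d → ℕ) i + 1 = ∑ i, n i := by
  have h : n - Pi.single j 1 + Pi.single j 1 = n :=
    tsub_add_cancel_of_le (single_one_le hj)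
  conv_rhs => rw [← h]
  simp [Finset.sum_add_distrib]

theorem symMonomial_eq_of_sum_eq {d : ℕ} {K : Type*} [NormedAddCommGroup K]
    [InnerProductSpace ℂ K] (V : Fin d → (K →L[ℂ] K)) {n : Fin d → ℕ} {N : ℕ}
    (hN : ∑ j, n j = N) :
    symMonomial V n = ∑ w ∈ Finset.univ.filter
      (fun w : Fin N → Fin d => ∀ j, (Finset.univ.filter (fun i => w i = j)).card = n j),
      (List.ofFn (fun i => V (w i))).prod := by
  subst hN
  rfl

theorem symMonomial_zero {d : ℕ} {K : Type*} [NormedAddCommGroup K]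
    [InnerProductSpace ℂ K] (V : Fin d → (K →L[ℂ] K)) : symMonomial V 0 = 1 := by
  rw [symMonomial_eq_of_sum_eq V (N := 0) (by simp)]
  simp

/-- Splitting a symmetrized monomial according to the first letter of its words. -/
theorem symMonomial_eq_sum_mul {d : ℕ} {K : Type*} [NormedAddCommGroup K]
    [InnerProductSpace ℂ K] (V : Fin d → (K →L[ℂ] K)) {n : Fin d → ℕ} (hn : n ≠ 0) :
    symMonomial V n =
      ∑ j, if 0 < n j then V j * symMonomial V (n - Pi.single j 1) else 0 := by
  have hsum (j : Fin d) (hj : 0 < n j) :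
      ∑ i, (n - Pi.single j 1 : Fin d → ℕ) i + 1 = ∑ i, n i := sum_sub_single_add_one hj
  obtain ⟨N, hN⟩ : ∃ N, ∑ j, n j = N + 1 := by
    obtain ⟨j, hj : n j ≠ 0⟩ := Function.ne_iff.mp hn
    exact ⟨_, (hsum j (Nat.pos_of_ne_zero hj)).symm⟩
  rw [symMonomial_eq_of_sum_eq V hN, Finset.sum_filter,
    ← (Fin.consEquiv (fun _ => Fin d)).sum_comp, Fintype.sum_prod_type]
  refine Finset.sum_congr rfl fun j _ => ?_
  split_ifs with hj
  · have hN' : ∑ i, (n - Pi.single j 1 : Fin d → ℕ) i = N := by have := hsum j hj; omega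
    rw [symMonomial_eq_of_sum_eq V hN', Finset.sum_filter, Finset.mul_sum]
    refine Finset.sum_congr rfl fun w _ => ?_
    have hiff : (∀ k, (Finset.univ.filter
          (fun i => Fin.consEquiv (fun _ => Fin d) (j, w) i = k)).card = n k) ↔
        ∀ k, (Finset.univ.filter (fun i => w i = k)).card = (n - Pi.single j 1 : Fin d → ℕ) k := by
      refine forall_congr' fun k => ?_
      rw [Fin.card_filter_univ_succ]
      by_cases h : j = k
      · subst h
        simp [Fin.consEquiv]
        omega
      · simp [Fin.consEquiv, h, Ne.symm h]
    rw [if_congr hiff rfl rfl, mul_ite, mul_zero]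
    simp [Fin.consEquiv, List.ofFn_succ]
  · refine Finset.sum_eq_zero fun w _ => if_neg fun h => hj ?_
    rw [← h j, Finset.card_pos]
    exact ⟨0, Finset.mem_filter.mpr ⟨Finset.mem_univ _, rfl⟩⟩

theorem adjoint_mul_symMonomial {d : ℕ} {K : Type*} [NormedAddCommGroup K]
    [InnerProductSpace ℂ K] [CompleteSpace K] (V : Fin d → (K →L[ℂ] K))
    (hV : ∀ i j, (adjoint (V i)) * (V j) = if i = j then 1 else 0)
    {n : Fin d → ℕ} (hn : n ≠ 0) (i : Fin d) :
    adjoint (V i) * symMonomial V n =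
      if 0 < n i then symMonomial V (n - Pi.single i 1) else 0 := by
  rw [symMonomial_eq_sum_mul V hn, Finset.mul_sum, Finset.sum_eq_single i]
  · simp [mul_ite, ← mul_assoc, hV]
  · intro j _ hj
    simp [mul_ite, ← mul_assoc, hV, Ne.symm hj]
  · simp

theorem adjoint_symMonomial_mul_symMonomial {d : ℕ} {K : Type*} [NormedAddCommGroup K]
    [InnerProductSpace ℂ K] [CompleteSpace K] (V : Fin d → (K →L[ℂ] K))
    (hV : ∀ i j, (adjoint (V i)) * (V j) = if i = j then 1 else 0)
    {m n : Fin d → ℕ} (hm : m ≠ 0) (hn : n ≠ 0) :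
    adjoint (symMonomial V n) * symMonomial V m =
      ∑ j, if 0 < n j ∧ 0 < m j then
        adjoint (symMonomial V (n - Pi.single j 1)) * symMonomial V (m - Pi.single j 1)
      else 0 := by
  rw [symMonomial_eq_sum_mul V hn, map_sum, Finset.sum_mul]
  refine Finset.sum_congr rfl fun j _ => ?_
  by_cases hj : 0 < n j
  · have : adjoint (V j * symMonomial V (n - Pi.single j 1)) =
        adjoint (symMonomial V (n - Pi.single j 1)) * adjoint (V j) := adjoint_comp _ _
    simp [hj, this, mul_assoc, adjoint_mul_symMonomial V hV hm, mul_ite]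
  · simp [hj]

/-- The Pascal-type recurrence for multinomial coefficients. -/
theorem multinomial_eq_sum {d : ℕ} {n : Fin d → ℕ} (hn : n ≠ 0) :
    Nat.multinomial Finset.univ n =
      ∑ j, if 0 < n j then Nat.multinomial Finset.univ (n - Pi.single j 1) else 0 := by
  have hpos : 0 < ∏ i, (n i).factorial := Finset.prod_pos fun i _ => Nat.factorial_pos _
  refine Nat.eq_of_mul_eq_mul_left hpos ?_
  rw [Nat.multinomial_spec, Finset.mul_sum]
  obtain ⟨N, hN⟩ : ∃ N, ∑ j, n j = N + 1 := by
    obtain ⟨j, hj : n j ≠ 0⟩ := Function.ne_iff.mp hn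
    exact ⟨_, (sum_sub_single_add_one (Nat.pos_of_ne_zero hj)).symm⟩
  rw [hN, Nat.factorial_succ, ← hN, Finset.sum_mul]
  refine Finset.sum_congr rfl fun j _ => ?_
  split_ifs with hj
  · have hN' : ∑ i, (n - Pi.single j 1 : Fin d → ℕ) i = N := by
      have := sum_sub_single_add_one hj
      omega
    have hprod : ∏ i, (n i).factorial =
        n j * ∏ i, ((n - Pi.single j 1 : Fin d → ℕ) i).factorial := by
      have hsplit (f : Fin d → ℕ) : ∏ i, f i = f j * ∏ i ∈ Finset.univ.erase j, f i :=
        (Finset.mul_prod_erase _ f (Finset.mem_univ j)).symm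
      rw [hsplit, hsplit, ← mul_assoc]
      congr 1
      · simp [Nat.mul_factorial_pred hj.ne']
      · refine Finset.prod_congr rfl fun i hi => ?_
        simp [Finset.ne_of_mem_erase hi]
    rw [hprod, mul_assoc, Nat.multinomial_spec, hN']
  · simp [Nat.eq_zero_of_not_pos hj]

theorem adjoint_symMonomial_mul_symMonomial_of_le {d : ℕ} {K : Type*} [NormedAddCommGroup K]
    [InnerProductSpace ℂ K] [CompleteSpace K] (V : Fin d → (K →L[ℂ] K))
    (hV : ∀ i j, (adjoint (V i)) * (V j) = if i = j then 1 else 0)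
    {m n : Fin d → ℕ} (h : n ≤ m) :
    adjoint (symMonomial V n) * symMonomial V m
      = ((Nat.multinomial Finset.univ n : ℂ)) • symMonomial V (m - n) := by
  induction hN : ∑ j, n j generalizing m n with
  | zero =>
    obtain rfl : n = 0 := by
      ext j
      simpa using Finset.sum_eq_zero_iff.mp hN j
    have h1 : adjoint (1 : K →L[ℂ] K) = 1 := star_one _
    simp [symMonomial_zero, h1, Nat.multinomial]
  | succ N ih =>
    have hn : n ≠ 0 := by
      rintro rfl
      simp at hN
    have hm : m ≠ 0 := by
      rintro rfl
      exact hn (nonpos_iff_eq_zero.mp h)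
    rw [adjoint_symMonomial_mul_symMonomial V hV hm hn, multinomial_eq_sum hn, Nat.cast_sum,
      Finset.sum_smul]
    refine Finset.sum_congr rfl fun j _ => ?_
    by_cases hj : 0 < n j
    · have hsub : m - Pi.single j 1 - (n - Pi.single j 1) = m - n :=
        tsub_tsub_tsub_cancel_right (single_one_le hj)
      rw [if_pos ⟨hj, hj.trans_le (h j)⟩, if_pos hj, ih (tsub_le_tsub_right h _)
        (by have := sum_sub_single_add_one hj; omega), hsub]
    · simp [hj]

theorem adjoint_symMonomial_mul_symMonomial_of_not_le {d : ℕ} {K : Type*}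
    [NormedAddCommGroup K] [InnerProductSpace ℂ K] [CompleteSpace K] (V : Fin d → (K →L[ℂ] K))
    (hV : ∀ i j, (adjoint (V i)) * (V j) = if i = j then 1 else 0)
    {m n : Fin d → ℕ} (hnm : ¬ n ≤ m) (hmn : ¬ m ≤ n) :
    adjoint (symMonomial V n) * symMonomial V m = 0 := by
  induction hN : ∑ j, n j using Nat.strong_induction_on generalizing m n with
  | _ N ih =>
    have hn : n ≠ 0 := by
      rintro rfl
      exact hnm zero_le
    have hm : m ≠ 0 := by
      rintro rfl
      exact hmn zero_le
    rw [adjoint_symMonomial_mul_symMonomial V hV hm hn]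
    refine Finset.sum_eq_zero fun j _ => ?_
    split_ifs with hj
    · have hnj : Pi.single j 1 ≤ n := single_one_le hj.1
      have hmj : Pi.single j 1 ≤ m := single_one_le hj.2
      exact ih _ (by have := sum_sub_single_add_one hj.1; omega)
        (by rwa [tsub_le_tsub_iff_right hmj]) (by rwa [tsub_le_tsub_iff_right hnj]) rfl
    · rfl

/-- For a row isometry `V` on a complex Hilbert space `K` and
multi-indices `m, n ∈ ℕ^d` (ordered componentwise): if `n ≤ m` then
`(V^{(n)})* V^{(m)} = (|n|!/n!) V^{(m−n)}`; if `m ≤ n` then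
`(V^{(n)})* V^{(m)} = (|m|!/m!) (V^{(n−m)})*`; and if `m, n` are incomparable then
`(V^{(n)})* V^{(m)} = 0`.  Here `|n|!/n!` is the multinomial coefficient. -/
theorem row_isometry_symMonomial_relations
    {d : ℕ} (hd : 1 ≤ d)
    {K : Type*} [NormedAddCommGroup K] [InnerProductSpace ℂ K] [CompleteSpace K]
    (V : Fin d → (K →L[ℂ] K))
    (hV : ∀ i j, (adjoint (V i)) * (V j) = if i = j then 1 else 0)
    (m n : Fin d → ℕ) :
    (n ≤ m →
      adjoint (symMonomial V n) * symMonomial V m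
        = ((Nat.multinomial Finset.univ n : ℂ)) • symMonomial V (m - n)) ∧
    (m ≤ n →
      adjoint (symMonomial V n) * symMonomial V m
        = ((Nat.multinomial Finset.univ m : ℂ)) • adjoint (symMonomial V (n - m))) ∧
    (¬ n ≤ m → ¬ m ≤ n →
      adjoint (symMonomial V n) * symMonomial V m = 0) := by
  refine ⟨adjoint_symMonomial_mul_symMonomial_of_le V hV, fun h => ?_,
    adjoint_symMonomial_mul_symMonomial_of_not_le V hV⟩
  have key := congrArg star (adjoint_symMonomial_mul_symMonomial_of_le V hV h)
  simpa [← star_eq_adjoint] using key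
end

section
/- Let d ≥ 1, let K be a complex Hilbert space and let V = (V₁,…,V_d) be a row isometry on K. Then the closure in operator norm of the linear span of the set { (I − ∑_{k=1}^d conj(w_k) V_k)⁻¹ : w ∈ 𝔹^d } equals the closure in operator norm of the linear span of the symmetrized monomials { V^{(n)} : n ∈ ℕ^d }. -/
open ContinuousLinearMap

/-- For `n` of total degree `m`, the symmetrized monomial is a sum over words of length `m`. -/
theorem symMonomial_eq_sum_words {d : ℕ} {K : Type*} [NormedAddCommGroup K]
    [InnerProductSpace ℂ K] (V : Fin d → (K →L[ℂ] K)) {m : ℕ} {n : Fin d → ℕ}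
    (h : ∑ j, n j = m) :
    symMonomial V n = ∑ w : Fin m → Fin d with
      (fun j => (Finset.univ.filter (fun i => w i = j)).card) = n,
        (List.ofFn (fun i => V (w i))).prod := by
  subst h
  simp only [symMonomial, funext_iff]

/-- Noncommutative expansion of a power of a linear combination, over words. -/
theorem sum_smul_pow_eq_sum_words {ι R A : Type*} [Fintype ι] [DecidableEq ι] [CommSemiring R]
    [Semiring A] [Algebra R A] (V : ι → A) (c : ι → R) (m : ℕ) :
    (∑ k, c k • V k) ^ m =
      ∑ w : Fin m → ι, (∏ i, c (w i)) • (List.ofFn (fun i => V (w i))).prod := by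
  have h := (MultilinearMap.mkPiAlgebraFin R m A).map_sum (fun _ k => c k • V k)
  simp only [MultilinearMap.map_smul_univ, MultilinearMap.mkPiAlgebraFin_apply] at h
  rw [← h, List.ofFn_const, List.prod_replicate]

/-- Multinomial expansion of a power of a linear combination in symmetrized monomials. -/
theorem sum_smul_pow_eq_sum_symMonomial {d : ℕ} {K : Type*} [NormedAddCommGroup K]
    [InnerProductSpace ℂ K] (V : Fin d → (K →L[ℂ] K)) (c : Fin d → ℂ) (m : ℕ) :
    (∑ k, c k • V k) ^ m =
      ∑ n ∈ Finset.piAntidiag Finset.univ m, (∏ j, c j ^ n j) • symMonomial V n := by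
  rw [sum_smul_pow_eq_sum_words,
    ← Finset.sum_fiberwise_of_maps_to (t := Finset.piAntidiag Finset.univ m)
      (g := fun w : Fin m → Fin d => fun j => (Finset.univ.filter (fun i => w i = j)).card)]
  · refine Finset.sum_congr rfl fun n hn => ?_
    rw [symMonomial_eq_sum_words V (Finset.mem_piAntidiag.1 hn).1, Finset.smul_sum]
    refine Finset.sum_congr rfl fun w hw => ?_
    congr 1
    rw [← (Finset.mem_filter.1 hw).2, ← Finset.prod_fiberwise Finset.univ w]
    refine Finset.prod_congr rfl fun j _ => ?_
    rw [Finset.prod_congr rfl (g := fun _ => c j), Finset.prod_const]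
    intro i hi
    rw [(Finset.mem_filter.1 hi).2]
  · intro w _
    rw [Finset.mem_piAntidiag]
    refine ⟨?_, by simp⟩
    rw [← Finset.card_eq_sum_card_fiberwise (fun _ _ => Finset.mem_coe.2 (Finset.mem_univ _))]
    simp

/-- If all values of a vector-valued polynomial lie in a subspace, so do its
coefficients. -/
theorem mem_of_forall_sum_prod_pow_smul_mem {σ k E : Type*} [Fintype σ] [DecidableEq σ] [Field k]
    [Infinite k] [AddCommGroup E] [Module k E] (M : Submodule k E) (s : Finset (σ → ℕ))
    (a : (σ → ℕ) → E) (h : ∀ c : σ → k, ∑ n ∈ s, (∏ j, c j ^ n j) • a n ∈ M)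
    {n : σ → ℕ} (hn : n ∈ s) : a n ∈ M := by
  by_contra hna
  obtain ⟨φ, hφ, hM⟩ := M.exists_le_ker_of_notMem hna
  have hP : ∑ n ∈ s, MvPolynomial.monomial (Finsupp.equivFunOnFinite.symm n) (φ (a n)) = 0 := by
    refine MvPolynomial.funext fun c => ?_
    have := hM (h c)
    simpa [MvPolynomial.eval_monomial, Finsupp.prod_fintype, mul_comm] using this
  have := congrArg (MvPolynomial.coeff (Finsupp.equivFunOnFinite.symm n)) hP
  rw [MvPolynomial.coeff_sum, Finset.sum_eq_single n] at this
  · exact hφ (by simpa using this)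
  · intro b _ hb
    rw [MvPolynomial.coeff_monomial, if_neg (by simpa using hb)]
  · exact fun hn' => (hn' hn).elim

/-- A closed subspace containing the resolvents `(1 - tA)⁻¹` for all small `t` contains every
power of `A`. -/
theorem pow_mem_of_eventually_inverse_one_sub_smul_mem {B : Type*} [NormedRing B]
    [NormedAlgebra ℂ B] [CompleteSpace B] (M : Submodule ℂ B) (hM : IsClosed (M : Set B)) (A : B)
    (h : ∀ᶠ t : ℂ in nhds 0, Ring.inverse (1 - t • A) ∈ M) (m : ℕ) : A ^ m ∈ M := by
  induction m using Nat.strong_induction_on with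
  | _ m ih =>
    have hsub : Filter.Tendsto (fun t : ℂ => 1 - t • A) (nhds 0) (nhds 1) := by
      have : Continuous fun t : ℂ => 1 - t • A := by fun_prop
      simpa using this.tendsto 0
    have hinv : Filter.Tendsto (fun t : ℂ => A ^ m * Ring.inverse (1 - t • A)) (nhds 0)
        (nhds (A ^ m)) := by
      have h1 := (NormedRing.inverse_continuousAt (1 : Bˣ)).tendsto
      rw [Units.val_one, Ring.inverse_one] at h1
      simpa using (h1.comp hsub).const_mul (A ^ m)
    have hunit : ∀ᶠ t : ℂ in nhds 0, IsUnit (1 - t • A) :=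
      hsub.eventually (Units.isOpen.mem_nhds isUnit_one)
    refine hM.mem_of_tendsto (hinv.mono_left (nhdsWithin_le_nhds (s := {0}ᶜ))) ?_
    filter_upwards [nhdsWithin_le_nhds h, nhdsWithin_le_nhds hunit, self_mem_nhdsWithin]
      with t ht hu ht0
    have hgeom : Ring.inverse (1 - t • A) - ∑ i ∈ Finset.range m, t ^ i • A ^ i
        = t ^ m • (A ^ m * Ring.inverse (1 - t • A)) := by
      have hg := geom_sum_mul_neg (t • A) m
      have hg' := congrArg (· * Ring.inverse (1 - t • A)) hg
      simp only [mul_assoc, Ring.mul_inverse_cancel _ hu, mul_one, sub_mul, one_mul,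
        smul_pow, smul_mul_assoc] at hg'
      rw [hg', sub_sub_cancel]
    have hmem : t ^ m • (A ^ m * Ring.inverse (1 - t • A)) ∈ M := by
      rw [← hgeom]
      exact M.sub_mem ht (M.sum_mem fun i hi => M.smul_mem _ (ih i (Finset.mem_range.1 hi)))
    exact (M.smul_mem_iff (pow_ne_zero m ht0)).1 hmem

/-- A closed subspace containing all powers of a strict contraction `A` contains `(1 - A)⁻¹`. -/
theorem inverse_one_sub_mem_of_forall_pow_mem {B : Type*} [NormedRing B] [NormedAlgebra ℂ B]
    [CompleteSpace B] (M : Submodule ℂ B) (hM : IsClosed (M : Set B)) {A : B} (hA : ‖A‖ < 1)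
    (h : ∀ m : ℕ, A ^ m ∈ M) : Ring.inverse (1 - A) ∈ M := by
  rw [← geom_series_eq_inverse A hA]
  exact hM.mem_of_tendsto (summable_geometric_of_norm_lt_one hA).hasSum
    (Filter.Eventually.of_forall fun s => M.sum_mem fun i _ => h i)

/-- A linear combination of the entries of a row isometry has norm at most the Euclidean norm of
its coefficients. -/
theorem norm_sum_conj_smul_le {d : ℕ} {K : Type*} [NormedAddCommGroup K] [InnerProductSpace ℂ K]
    [CompleteSpace K] (V : Fin d → (K →L[ℂ] K))
    (hV : ∀ i j, (adjoint (V i)) * (V j) = if i = j then 1 else 0)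
    (w : EuclideanSpace ℂ (Fin d)) : ‖∑ k, (starRingEnd ℂ) (w k) • V k‖ ≤ ‖w‖ := by
  set A := ∑ k, (starRingEnd ℂ) (w k) • V k with hA
  have hAA : star A * A = ((‖w‖ ^ 2 : ℝ) : ℂ) • (1 : K →L[ℂ] K) := by
    have hV' : ∀ i j, star (V i) * V j = if i = j then 1 else 0 := hV
    simp only [hA, star_sum, star_smul, Finset.sum_mul_sum, smul_mul_smul_comm, hV', smul_ite,
      smul_zero, Finset.sum_ite_eq, Finset.mem_univ, if_true]
    rw [← Finset.sum_smul, EuclideanSpace.norm_sq_eq]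
    congr 1
    push_cast
    refine Finset.sum_congr rfl fun k _ => ?_
    simp [Complex.mul_conj']
  have h1 : ‖A‖ * ‖A‖ ≤ ‖w‖ * ‖w‖ := by
    rw [← CStarRing.norm_star_mul_self, hAA, norm_smul, Complex.norm_real, Real.norm_eq_abs,
      abs_of_nonneg (by positivity), ← sq]
    exact mul_le_of_le_one_right (by positivity) ContinuousLinearMap.norm_id_le
  exact abs_le_of_sq_le_sq' (by simpa [sq] using h1) (norm_nonneg w) |>.2

/-- For a row isometry `V` on a complex Hilbert space `K`, the norm
closure of the span of `{ (I − Vw*)⁻¹ : w ∈ 𝔹^d }` equals the norm closure of the span of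
the symmetrized monomials `{ V^{(n)} : n ∈ ℕ^d }`. -/
theorem row_isometry_kernels_span_dense
    {d : ℕ} (hd : 1 ≤ d)
    {K : Type*} [NormedAddCommGroup K] [InnerProductSpace ℂ K] [CompleteSpace K]
    (V : Fin d → (K →L[ℂ] K))
    (hV : ∀ i j, (adjoint (V i)) * (V j) = if i = j then 1 else 0) :
    (Submodule.span ℂ
        {A : K →L[ℂ] K | ∃ w : EuclideanSpace ℂ (Fin d), ‖w‖ < 1 ∧
          A = Ring.inverse (1 - ∑ k, (starRingEnd ℂ) (w k) • V k)}).topologicalClosure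
      = (Submodule.span ℂ
          {A : K →L[ℂ] K | ∃ n : Fin d → ℕ, A = symMonomial V n}).topologicalClosure := by
  apply le_antisymm
  · refine Submodule.topologicalClosure_minimal _ (Submodule.span_le.2 ?_)
      (Submodule.isClosed_topologicalClosure _)
    rintro _ ⟨w, hw, rfl⟩
    refine inverse_one_sub_mem_of_forall_pow_mem _ (Submodule.isClosed_topologicalClosure _)
      ((norm_sum_conj_smul_le V hV w).trans_lt hw) fun m => ?_
    rw [sum_smul_pow_eq_sum_symMonomial]
    exact Submodule.le_topologicalClosure _ (Submodule.sum_mem _ fun n _ =>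
      Submodule.smul_mem _ _ (Submodule.subset_span ⟨n, rfl⟩))
  · refine Submodule.topologicalClosure_minimal _ (Submodule.span_le.2 ?_)
      (Submodule.isClosed_topologicalClosure _)
    rintro _ ⟨n, rfl⟩
    refine mem_of_forall_sum_prod_pow_smul_mem _ (Finset.piAntidiag Finset.univ (∑ j, n j))
      (symMonomial V) (fun c => ?_) (by simp [Finset.mem_piAntidiag])
    rw [← sum_smul_pow_eq_sum_symMonomial]
    refine pow_mem_of_eventually_inverse_one_sub_smul_mem _
      (Submodule.isClosed_topologicalClosure _) _ ?_ _
    let w : ℂ → EuclideanSpace ℂ (Fin d) := fun t =>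
      (starRingEnd ℂ) t • WithLp.toLp 2 (fun k => (starRingEnd ℂ) (c k))
    have hw : Continuous w := Complex.continuous_conj.smul continuous_const
    have hball : ∀ᶠ t in nhds 0, ‖w t‖ < 1 :=
      hw.norm.continuousAt.eventually_lt continuousAt_const (by simp [w])
    filter_upwards [hball] with t ht
    refine Submodule.le_topologicalClosure _ (Submodule.subset_span ⟨w t, ht, ?_⟩)
    simp [w, Finset.smul_sum, smul_smul]
end

section
/- Let d ≥ 1, let K be a complex Hilbert space and let V = (V₁,…,V_d) be a row isometry on K. Then for all z, w ∈ 𝔹^d: (I − zV*)⁻¹ (I − Vw*)⁻¹ = (1/2) · (H(z,V) + H(w,V)*) / (1 − ⟨z,w⟩), where H(z,V) := (I + zV*)(I − zV*)⁻¹. -/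
open ContinuousLinearMap

/-- The product `(zV*)(Vw*)` is the scalar `⟨z, w⟩` for a row isometry `V`. -/
theorem sum_smul_adjoint_mul_sum_smul {ι K : Type*} [Fintype ι] [DecidableEq ι]
    [NormedAddCommGroup K] [InnerProductSpace ℂ K] [CompleteSpace K]
    (V : ι → (K →L[ℂ] K))
    (hV : ∀ i j, (adjoint (V i)) * (V j) = if i = j then 1 else 0) (z w : ι → ℂ) :
    (∑ j, z j • adjoint (V j)) * (∑ k, (starRingEnd ℂ) (w k) • V k)
      = (∑ j, z j * (starRingEnd ℂ) (w j)) • (1 : K →L[ℂ] K) := by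
  rw [Finset.sum_mul_sum, Finset.sum_smul]
  refine Finset.sum_congr rfl fun i _ => ?_
  rw [Finset.sum_eq_single i]
  · rw [smul_mul_smul_comm, hV, if_pos rfl]
  · intro j _ hj
    rw [smul_mul_smul_comm, hV, if_neg hj.symm, smul_zero]
  · simp

theorem adjoint_sum_smul_adjoint {ι K : Type*} [Fintype ι]
    [NormedAddCommGroup K] [InnerProductSpace ℂ K] [CompleteSpace K]
    (V : ι → (K →L[ℂ] K)) (w : ι → ℂ) :
    adjoint (∑ j, w j • adjoint (V j)) = ∑ k, (starRingEnd ℂ) (w k) • V k := by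
  simp [map_sum, ← star_eq_adjoint, star_smul]

theorem norm_sum_smul_adjoint_le {ι K : Type*} [Fintype ι] [DecidableEq ι]
    [NormedAddCommGroup K] [InnerProductSpace ℂ K] [CompleteSpace K]
    (V : ι → (K →L[ℂ] K))
    (hV : ∀ i j, (adjoint (V i)) * (V j) = if i = j then 1 else 0)
    (z : EuclideanSpace ℂ ι) :
    ‖∑ j, z j • adjoint (V j)‖ ≤ ‖z‖ := by
  have hmul := sum_smul_adjoint_mul_sum_smul V hV z z
  rw [← adjoint_sum_smul_adjoint] at hmul
  have hnorm : ‖(∑ j, z j * (starRingEnd ℂ) (z j) : ℂ)‖ = ‖z‖ * ‖z‖ := by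
    have h : (∑ j, z j * (starRingEnd ℂ) (z j) : ℂ) = inner ℂ z z := by
      simp only [PiLp.inner_apply, RCLike.inner_apply]
    rw [h, inner_self_eq_norm_sq_to_K]
    simp [sq]
  refine abs_le_of_sq_le_sq' ?_ (norm_nonneg z) |>.2
  rw [sq, sq, ← CStarRing.norm_self_mul_star, star_eq_adjoint, hmul, norm_smul, hnorm]
  exact mul_le_of_le_one_right (by positivity) norm_id_le

/-- The Herglotz kernel identity for elements `a`, `b` of an algebra. -/
theorem inverse_one_sub_mul_inverse_one_sub {R : Type*} [Ring R] [Algebra ℂ R] {a b : R} {c : ℂ}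
    (ha : IsUnit (1 - a)) (hb : IsUnit (1 - b)) (hab : a * b = c • 1) (hc : 1 - c ≠ 0) :
    Ring.inverse (1 - a) * Ring.inverse (1 - b)
      = (2 * (1 - c))⁻¹ •
        ((1 + a) * Ring.inverse (1 - a) + Ring.inverse (1 - b) * (1 + b)) := by
  have hcomm : (1 + a) * Ring.inverse (1 - a) = Ring.inverse (1 - a) * (1 + a) := by
    refine ha.mul_left_cancel ?_
    rw [← mul_assoc, ← mul_assoc, Ring.mul_inverse_cancel _ ha,
      show (1 - a) * (1 + a) = (1 + a) * (1 - a) by noncomm_ring, mul_assoc,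
      Ring.mul_inverse_cancel _ ha, mul_one, one_mul]
  have hcomm' : Ring.inverse (1 - b) * (1 + b) = (1 + b) * Ring.inverse (1 - b) := by
    refine hb.mul_left_cancel ?_
    rw [← mul_assoc, ← mul_assoc, Ring.mul_inverse_cancel _ hb,
      show (1 - b) * (1 + b) = (1 + b) * (1 - b) by noncomm_ring, mul_assoc,
      Ring.mul_inverse_cancel _ hb, mul_one, one_mul]
  rw [eq_inv_smul_iff₀ (mul_ne_zero two_ne_zero hc), hcomm, hcomm']
  refine ha.mul_left_cancel (hb.mul_right_cancel ?_)
  have hl : (1 - a) * ((2 * (1 - c)) • (Ring.inverse (1 - a) * Ring.inverse (1 - b))) * (1 - b)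
      = (2 * (1 - c)) • 1 := by
    rw [mul_smul_comm, smul_mul_assoc, ← mul_assoc, Ring.mul_inverse_cancel _ ha, one_mul,
      Ring.inverse_mul_cancel _ hb]
  have hr : (1 - a) * (Ring.inverse (1 - a) * (1 + a) + (1 + b) * Ring.inverse (1 - b)) * (1 - b)
      = (1 + a) * (1 - b) + (1 - a) * (1 + b) := by
    rw [mul_add, add_mul, ← mul_assoc (1 - a), Ring.mul_inverse_cancel _ ha, one_mul,
      ← mul_assoc (1 - a), mul_assoc _ (Ring.inverse (1 - b)), Ring.inverse_mul_cancel _ hb,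
      mul_one]
  have he : (1 + a) * (1 - b) + (1 - a) * (1 + b) = 2 - 2 * (a * b) := by
    rw [← one_add_one_eq_two]
    noncomm_ring
  rw [hl, hr, he, hab]
  simp only [Algebra.smul_def, map_mul, map_sub, map_ofNat, mul_one, mul_sub]

/-- For a row isometry `V` on a complex Hilbert space `K` and
`z, w ∈ 𝔹^d`:
`(I − zV*)⁻¹ (I − Vw*)⁻¹ = (1/2)(H(z,V) + H(w,V)*)/(1 − ⟨z,w⟩)`,
where `H(z,V) = (I + zV*)(I − zV*)⁻¹`. -/
theorem row_isometry_kernel_identity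
    {d : ℕ} (hd : 1 ≤ d)
    {K : Type*} [NormedAddCommGroup K] [InnerProductSpace ℂ K] [CompleteSpace K]
    (V : Fin d → (K →L[ℂ] K))
    (hV : ∀ i j, (adjoint (V i)) * (V j) = if i = j then 1 else 0)
    (z w : EuclideanSpace ℂ (Fin d)) (hz : ‖z‖ < 1) (hw : ‖w‖ < 1) :
    Ring.inverse (1 - ∑ j, z j • adjoint (V j))
        * Ring.inverse (1 - ∑ k, (starRingEnd ℂ) (w k) • V k)
      = ((2 * (1 - ∑ j, z j * (starRingEnd ℂ) (w j)))⁻¹ : ℂ) •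
          (((1 + ∑ j, z j • adjoint (V j))
              * Ring.inverse (1 - ∑ j, z j • adjoint (V j)))
            + adjoint ((1 + ∑ j, w j • adjoint (V j))
                * Ring.inverse (1 - ∑ j, w j • adjoint (V j)))) := by
  have hone_sub_c : (1 - ∑ j, z j * (starRingEnd ℂ) (w j) : ℂ) ≠ 0 := by
    have h : (∑ j, z j * (starRingEnd ℂ) (w j) : ℂ) = inner ℂ w z := by
      simp [PiLp.inner_apply]
    rw [h, sub_ne_zero]
    intro h1
    have hle := norm_inner_le_norm (𝕜 := ℂ) w z
    rw [← h1, norm_one] at hle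
    nlinarith [norm_nonneg z, norm_nonneg w]
  have hunit (u : EuclideanSpace ℂ (Fin d)) (hu : ‖u‖ < 1) :
      IsUnit (1 - ∑ j, u j • adjoint (V j)) :=
    isUnit_one_sub_of_norm_lt_one ((norm_sum_smul_adjoint_le V hV u).trans_lt hu)
  have hstar : star (∑ j, w j • adjoint (V j)) = ∑ k, (starRingEnd ℂ) (w k) • V k :=
    adjoint_sum_smul_adjoint V w
  have hunit_star : IsUnit (1 - ∑ k, (starRingEnd ℂ) (w k) • V k) := by
    simpa only [star_sub, star_one, hstar] using (hunit w hw).star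
  rw [inverse_one_sub_mul_inverse_one_sub (hunit z hz) hunit_star
    (sum_smul_adjoint_mul_sum_smul V hV z w) hone_sub_c, ← star_eq_adjoint, star_mul,
    ← Ring.inverse_star, star_sub, star_add, star_one, hstar]
end

section
/- Let d ≥ 1 and let b, b₁, …, b_d : 𝔹^d → ℂ be functions satisfying b(z) − b(0) = ∑_{j=1}^d z_j b_j(z) for all z ∈ 𝔹^d (i.e. the b_j solve the Gleason problem for b). Define k^b(z,w) := (1 − b(z)·conj(b(w)))/(1 − ⟨z,w⟩) for z, w ∈ 𝔹^d. Then for all z, w ∈ 𝔹^d: ∑_{j=1}^d z_j · ( conj(w_j)·k^b(z,w) − b_j(z)·conj(b(w)) ) = k^b(z,w) − (1 − b(0)·conj(b(w))). (The right-hand side equals k^b(z,w) − k^b(0,w); this is the identity showing that the operators X_j k^b_w := conj(w_j) k^b_w − conj(b(w)) b_j solve the Gleason problem on reproducing kernels.) -/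
/-- The denominator of the Drury–Arveson kernel does not vanish on the open unit ball. -/
theorem one_sub_sum_mul_conj_ne_zero {ι : Type*} [Fintype ι] {z w : EuclideanSpace ℂ ι}
    (hz : ‖z‖ < 1) (hw : ‖w‖ < 1) : 1 - ∑ l, z l * (starRingEnd ℂ) (w l) ≠ 0 := by
  have h : ∑ l, z l * (starRingEnd ℂ) (w l) = inner ℂ w z := by
    simp [PiLp.inner_apply]
  rw [h, sub_ne_zero]
  intro h1
  have h2 : ‖inner ℂ w z‖ ≤ ‖w‖ * ‖z‖ := norm_inner_le_norm w z
  rw [← h1, norm_one] at h2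
  nlinarith [norm_nonneg z, norm_nonneg w]

/-- **Gleason identity on reproducing kernels.** If `b₁, …, b_d` solve the
Gleason problem for `b` on the ball, i.e. `b(z) − b(0) = ∑ j, z j · b_j(z)`, then with
`k^b(z,w) = (1 − b(z) conj(b(w)))/(1 − ⟨z,w⟩)` one has, for all `z, w ∈ 𝔹^d`,
`∑ j, z j (conj(w j) k^b(z,w) − b_j(z) conj(b(w))) = k^b(z,w) − (1 − b(0) conj(b(w)))`. -/
theorem gleason_identity_on_kernels
    {d : ℕ} (hd : 1 ≤ d)
    (b : EuclideanSpace ℂ (Fin d) → ℂ)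
    (bj : Fin d → EuclideanSpace ℂ (Fin d) → ℂ)
    (hgleason : ∀ z : EuclideanSpace ℂ (Fin d), ‖z‖ < 1 →
      b z - b 0 = ∑ j, z j * bj j z) :
    ∀ z w : EuclideanSpace ℂ (Fin d), ‖z‖ < 1 → ‖w‖ < 1 →
      (∑ j, z j * ((starRingEnd ℂ) (w j) *
            ((1 - b z * (starRingEnd ℂ) (b w))
              / (1 - ∑ l, z l * (starRingEnd ℂ) (w l)))
          - bj j z * (starRingEnd ℂ) (b w)))
        = (1 - b z * (starRingEnd ℂ) (b w)) / (1 - ∑ l, z l * (starRingEnd ℂ) (w l))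
          - (1 - b 0 * (starRingEnd ℂ) (b w)) := by
  intro z w hz hw
  have hden := one_sub_sum_mul_conj_ne_zero hz hw
  set S := ∑ l, z l * (starRingEnd ℂ) (w l) with hS
  set K := (1 - b z * (starRingEnd ℂ) (b w)) / (1 - S) with hK
  have hmul : K * (1 - S) = 1 - b z * (starRingEnd ℂ) (b w) := div_mul_cancel₀ _ hden
  have hsum : ∑ j, z j * ((starRingEnd ℂ) (w j) * K - bj j z * (starRingEnd ℂ) (b w))
      = S * K - (b z - b 0) * (starRingEnd ℂ) (b w) := by
    rw [hgleason z hz, hS, Finset.sum_mul, Finset.sum_mul, ← Finset.sum_sub_distrib]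
    exact Finset.sum_congr rfl fun j _ => by ring
  rw [hsum]
  linear_combination -hmul
end
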